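/- arXiv:2104.10188 — 3 statements merged into one kernel-verified Lean document; each statement's English description precedes it below -/
import Mathlib

section
/- Let T : ℝ^𝒳 → ℝ^𝒳 be a linear coherent map that satisfies the reachability condition (R1). Then there is a positive integer n such that for all integers k ≥ n and all x ∈ Aᶜ it holds that [(T|_{Aᶜ})ᵏ1](x) < 1, where 1 ∈ ℝ^{Aᶜ} is the constant function 1. -/
open Function Set

/-- A map `T : ℝ^𝒳 → ℝ^𝒳` is *coherent* if it is non-negatively homogeneous (C1),
super-additive (C2), and dominates the pointwise minimum (C3). -/
def Coherent {X : Type*} [Fintype X] [Nonempty X] (T : (X → ℝ) → (X → ℝ)) : Prop :=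
  (∀ (α : ℝ), 0 ≤ α → ∀ f, T (α • f) = α • T f) ∧
  (∀ f g, T f + T g ≤ T (f + g)) ∧
  (∀ (f : X → ℝ) (x : X), (⨅ y, f y) ≤ T f x)

/-- The reachability condition (R1) with respect to the target set `A`. -/
def Reach {X : Type*} (A : Set X) (T : (X → ℝ) → (X → ℝ)) : Prop :=
  ∀ x ∈ Aᶜ, ∃ n : ℕ, 0 < n ∧ 0 < T^[n] (A.indicator 1) x

/-- The restriction `M|_{Aᶜ}` of a map `M : ℝ^𝒳 → ℝ^𝒳` to `ℝ^{Aᶜ}`: the argument `f` is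
extended by zero to `𝒳` (this extension is `g·𝟙_{Aᶜ}` for any `g` with `g|_{Aᶜ} = f`),
`M` is applied, and the result is restricted to `Aᶜ`. -/
noncomputable def restr {X : Type*} (A : Set X) (M : (X → ℝ) → (X → ℝ)) :
    (↥(Aᶜ) → ℝ) → (↥(Aᶜ) → ℝ) :=
  fun f x => M (Function.extend (Subtype.val : ↥(Aᶜ) → X) f 0) x.val

section Restriction

variable {X : Type*} {A : Set X} {T : (X → ℝ) → (X → ℝ)}

theorem Coherent.nonneg [Fintype X] [Nonempty X] (hT : Coherent T) {f : X → ℝ} (hf : 0 ≤ f) :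
    0 ≤ T f :=
  fun x => (le_ciInf hf).trans (hT.2.2 f x)

theorem Coherent.monotone [Fintype X] [Nonempty X] (hT : Coherent T) : Monotone T := by
  intro f g hfg
  have h := hT.2.1 f (g - f)
  rw [add_sub_cancel] at h
  exact (le_add_of_nonneg_right (hT.nonneg (sub_nonneg.2 hfg))).trans h

theorem Coherent.map_one_le [Fintype X] [Nonempty X] (hlin : IsLinearMap ℝ T) (hT : Coherent T) :
    T 1 ≤ 1 := by
  intro x
  have h := hT.2.2 (-1) x
  simp only [hlin.map_neg, Pi.neg_apply, Pi.one_apply, ciInf_const] at h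
  simpa using h

theorem extend_val_le {f : ↥(Aᶜ) → ℝ} {g : X → ℝ} (hg : 0 ≤ g) (hfg : ∀ x, f x ≤ g x.val) :
    Function.extend (Subtype.val : ↥(Aᶜ) → X) f 0 ≤ g := by
  intro y
  by_cases hy : ∃ x : ↥(Aᶜ), x.val = y
  · obtain ⟨x, rfl⟩ := hy
    rw [Subtype.val_injective.extend_apply]
    exact hfg x
  · rw [Function.extend_apply' _ _ _ hy]
    exact hg y

theorem restr_monotone (hmono : Monotone T) : Monotone (restr A T) := by
  intro f g hfg x
  refine hmono (fun y => ?_) x.val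
  by_cases hy : ∃ z : ↥(Aᶜ), z.val = y
  · obtain ⟨z, rfl⟩ := hy
    simpa only [Subtype.val_injective.extend_apply] using hfg z
  · simp only [Function.extend_apply' _ _ _ hy, le_refl]

theorem restr_one_le [Fintype X] [Nonempty X] (hlin : IsLinearMap ℝ T) (hT : Coherent T) :
    restr A T 1 ≤ 1 := fun x =>
  (hT.monotone (extend_val_le zero_le_one fun _ => le_rfl) x.val).trans
    (hT.map_one_le hlin x.val)

theorem Coherent.iterate_nonneg [Fintype X] [Nonempty X] (hT : Coherent T) {g : X → ℝ}
    (hg : 0 ≤ g) (k : ℕ) : 0 ≤ T^[k] g := by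
  induction k with
  | zero => exact hg
  | succ k ih => rw [iterate_succ_apply']; exact hT.nonneg ih

theorem restr_iterate_le [Fintype X] [Nonempty X] (hT : Coherent T) {f : ↥(Aᶜ) → ℝ} {g : X → ℝ}
    (hg : 0 ≤ g) (hfg : ∀ x, f x ≤ g x.val) (k : ℕ) (x : ↥(Aᶜ)) :
    (restr A T)^[k] f x ≤ T^[k] g x.val := by
  induction k generalizing x with
  | zero => exact hfg x
  | succ k ih =>
    rw [iterate_succ_apply', iterate_succ_apply']
    exact hT.monotone (extend_val_le (hT.iterate_nonneg hg k) ih) x.val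

theorem iterate_add_iterate_le_one [Fintype X] [Nonempty X] (hlin : IsLinearMap ℝ T)
    (hT : Coherent T) {f g : X → ℝ} (hfg : f + g ≤ 1) (k : ℕ) : T^[k] f + T^[k] g ≤ 1 := by
  induction k with
  | zero => exact hfg
  | succ k ih =>
    rw [iterate_succ_apply', iterate_succ_apply', ← hlin.map_add]
    exact (hT.monotone ih).trans (hT.map_one_le hlin)

end Restriction

theorem stmt11 {X : Type*} [Fintype X] [Nonempty X] (A : Set X)
    (hA : A.Nonempty) (hAc : (Aᶜ : Set X).Nonempty)
    (T : (X → ℝ) → (X → ℝ)) (hlin : IsLinearMap ℝ T) (hT : Coherent T)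
    (hR : Reach A T) :
    ∃ n : ℕ, 0 < n ∧ ∀ k : ℕ, n ≤ k → ∀ x : ↥(Aᶜ), (restr A T)^[k] 1 x < 1 := by
  have hanti : Antitone fun k : ℕ => (restr A T)^[k] 1 :=
    (restr_monotone hT.monotone).antitone_iterate_of_map_le (restr_one_le hlin hT)
  have hlt : ∀ x : ↥(Aᶜ), ∃ n : ℕ, (restr A T)^[n] 1 x < 1 := by
    intro x
    obtain ⟨n, -, hn⟩ := hR x.val x.property
    refine ⟨n, ?_⟩
    have hle := restr_iterate_le (A := A) (f := 1) (g := Aᶜ.indicator 1) hT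
      (Set.indicator_nonneg fun _ _ => zero_le_one)
      (fun y => (Set.indicator_of_mem y.property (1 : X → ℝ)).ge) n x
    have hsum := iterate_add_iterate_le_one hlin hT
      (Set.indicator_self_add_compl A (1 : X → ℝ)).le n x.val
    simp only [Pi.add_apply, Pi.one_apply] at hsum
    linarith
  choose n hn using hlt
  obtain ⟨N, hN⟩ := (Set.finite_range n).bddAbove
  exact ⟨N + 1, N.succ_pos, fun k hk x =>
    (hanti ((hN ⟨x, rfl⟩).trans ((Nat.le_succ N).trans hk)) x).trans_lt (hn x)⟩
end

section
/- Let T̲ : ℝ^𝒳 → ℝ^𝒳 be a coherent map and let 𝒯 be its dual representation, i.e., the set of all linear coherent maps T with T̲f ≤ Tf for all f ∈ ℝ^𝒳. Then the set of extreme points of 𝒯 is nonempty, and for every f ∈ ℝ^𝒳 there is an extreme point T of 𝒯 such that T̲f = Tf. -/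
open Function Set

/-- The dual representation of `Tl`: the set of all linear coherent maps that dominate `Tl`. -/
def DualRep {X : Type*} [Fintype X] [Nonempty X] (Tl : (X → ℝ) → (X → ℝ)) :
    Set ((X → ℝ) → (X → ℝ)) :=
  {T | IsLinearMap ℝ T ∧ Coherent T ∧ ∀ f, Tl f ≤ T f}

theorem Coherent.map_zero {X : Type*} [Fintype X] [Nonempty X] {Tl : (X → ℝ) → (X → ℝ)}
    (hTl : Coherent Tl) : Tl 0 = 0 := by
  simpa using hTl.1 0 le_rfl 0

theorem mem_dualRep_iff {X : Type*} [Fintype X] [Nonempty X] {Tl : (X → ℝ) → (X → ℝ)}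
    (hTl : Coherent Tl) (T : (X → ℝ) → (X → ℝ)) :
    T ∈ DualRep Tl ↔ (∀ f g, T (f + g) = T f + T g) ∧ (∀ (c : ℝ) f, T (c • f) = c • T f) ∧
      ∀ f, Tl f ≤ T f := by
  constructor
  · rintro ⟨hlin, -, hle⟩
    exact ⟨hlin.map_add, hlin.map_smul, hle⟩
  · rintro ⟨hadd, hsmul, hle⟩
    exact ⟨⟨hadd, hsmul⟩, ⟨fun c _ f => hsmul c f, fun f g => (hadd f g).ge,
      fun f x => (hTl.2.2 f x).trans (hle f x)⟩, hle⟩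

theorem isCompact_dualRep {X : Type*} [Fintype X] [Nonempty X] {Tl : (X → ℝ) → (X → ℝ)}
    (hTl : Coherent Tl) : IsCompact (DualRep Tl) := by
  have hbox : IsCompact (Set.univ.pi fun f : X → ℝ => Set.Icc (Tl f) (-Tl (-f))) :=
    isCompact_univ_pi fun f => isCompact_Icc
  refine hbox.of_isClosed_subset ?_ ?_
  · have heq : DualRep Tl = {T | (∀ f g, T (f + g) = T f + T g) ∧
        (∀ (c : ℝ) f, T (c • f) = c • T f) ∧ ∀ f, Tl f ≤ T f} :=
      Set.ext (mem_dualRep_iff hTl)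
    rw [heq]
    simp only [Set.ofPred_and, Set.ofPred_forall]
    refine IsClosed.inter ?_ (IsClosed.inter ?_ ?_)
    · exact isClosed_iInter fun f => isClosed_iInter fun g =>
        isClosed_eq (by fun_prop) (by fun_prop)
    · exact isClosed_iInter fun c => isClosed_iInter fun f =>
        isClosed_eq (by fun_prop) (by fun_prop)
    · exact isClosed_iInter fun f => isClosed_le (by fun_prop) (by fun_prop)
  · rintro T ⟨hlin, -, hle⟩ f -
    refine ⟨hle f, ?_⟩
    have h := hle (-f)
    rw [hlin.map_neg] at h
    exact le_neg.mp h

/-- The maps in the dual representation that attain the lower value at `f` form a face. -/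
theorem isExtreme_dualRep_eq {X : Type*} [Fintype X] [Nonempty X]
    (Tl : (X → ℝ) → (X → ℝ)) (f : X → ℝ) :
    IsExtreme ℝ (DualRep Tl) {T ∈ DualRep Tl | T f = Tl f} := by
  refine ⟨Set.sep_subset _ _, ?_⟩
  rintro T₁ h₁ T₂ h₂ T ⟨-, hT⟩ ⟨a, b, ha, hb, hab, rfl⟩
  refine ⟨h₁, funext fun x => le_antisymm ?_ (h₁.2.2 f x)⟩
  have e : a * T₁ f x + b * T₂ f x = Tl f x := congrFun hT x
  have h := mul_le_mul_of_nonneg_left (h₂.2.2 f x) hb.le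
  have hsum : a * Tl f x + b * Tl f x = Tl f x := by rw [← add_mul, hab, one_mul]
  exact le_of_mul_le_mul_left (by linarith) ha

theorem Coherent.exists_linearMap_apply_eq {X : Type*} [Fintype X] [Nonempty X]
    {Tl : (X → ℝ) → (X → ℝ)} (hTl : Coherent Tl) (f : X → ℝ) (x : X) :
    ∃ φ : (X → ℝ) →ₗ[ℝ] ℝ, φ f = Tl f x ∧ ∀ g, Tl g x ≤ φ g := by
  have hker : ∀ c : ℝ, c • f = 0 → c • Tl f x = 0 := by
    intro c hc
    rcases smul_eq_zero.mp hc with rfl | rfl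
    · simp
    · simp [hTl.map_zero]
  obtain ⟨φ, hφ, hle⟩ := exists_extension_of_le_sublinear
    (LinearPMap.mkSpanSingleton' (σ := RingHom.id ℝ) f (Tl f x) hker) (fun g => -Tl (-g) x)
    (fun c hc g => by
      have h := congrFun (hTl.1 c hc.le (-g)) x
      simp only [smul_neg, Pi.smul_apply, smul_eq_mul] at h
      simp [h])
    (fun g h => by
      have := hTl.2.1 (-g) (-h) x
      rw [← neg_add] at this
      simp only [Pi.add_apply] at this
      linarith)
    (by
      rintro ⟨g, hg⟩
      obtain ⟨c, rfl⟩ := Submodule.mem_span_singleton.mp hg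
      rw [LinearPMap.mkSpanSingleton'_apply]
      simp only [smul_eq_mul, RingHom.id_apply]
      rcases le_total 0 c with hc | hc
      · have h := hTl.2.1 (c • f) (-(c • f)) x
        rw [add_neg_cancel, hTl.map_zero, hTl.1 c hc] at h
        simp only [Pi.add_apply, Pi.smul_apply, smul_eq_mul, Pi.zero_apply] at h
        linarith
      · rw [← neg_smul, hTl.1 (-c) (neg_nonneg.mpr hc)]
        simp)
  refine ⟨φ, ?_, fun g => ?_⟩
  · have hf : f ∈ (LinearPMap.mkSpanSingleton' (σ := RingHom.id ℝ) f (Tl f x) hker).domain :=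
      Submodule.mem_span_singleton_self f
    exact (hφ ⟨f, hf⟩).trans (LinearPMap.mkSpanSingleton'_apply_self _ _ _ _)
  · have h := hle (-g)
    rw [map_neg, neg_neg] at h
    exact neg_le_neg_iff.mp h

theorem Coherent.exists_mem_dualRep_apply_eq {X : Type*} [Fintype X] [Nonempty X]
    {Tl : (X → ℝ) → (X → ℝ)} (hTl : Coherent Tl) (f : X → ℝ) :
    ∃ T ∈ DualRep Tl, T f = Tl f := by
  choose φ hφ hle using hTl.exists_linearMap_apply_eq f
  refine ⟨fun g x => φ x g, (mem_dualRep_iff hTl _).mpr ⟨?_, ?_, ?_⟩, funext hφ⟩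
  · exact fun g h => funext fun x => map_add (φ x) g h
  · exact fun c g => funext fun x => map_smul (φ x) c g
  · exact fun g x => hle x g

theorem stmt16 {X : Type*} [Fintype X] [Nonempty X]
    (Tl : (X → ℝ) → (X → ℝ)) (hTl : Coherent Tl) :
    (Set.extremePoints ℝ (DualRep Tl)).Nonempty ∧
    ∀ f : X → ℝ, ∃ T ∈ Set.extremePoints ℝ (DualRep Tl), Tl f = T f := by
  have key : ∀ f : X → ℝ, ∃ T ∈ Set.extremePoints ℝ (DualRep Tl), Tl f = T f := by
    intro f
    have hface : IsCompact {T ∈ DualRep Tl | T f = Tl f} :=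
      (isCompact_dualRep hTl).inter_right (isClosed_eq (continuous_apply f) continuous_const)
    obtain ⟨T, hT⟩ := hface.extremePoints_nonempty (hTl.exists_mem_dualRep_apply_eq f)
    exact ⟨T, (isExtreme_dualRep_eq Tl f).extremePoints_subset_extremePoints hT, hT.1.2.symm⟩
  exact ⟨(key 0).imp fun _ hT => hT.1, key⟩
end

section
/- Let T̲ : ℝ^𝒳 → ℝ^𝒳 be a coherent map satisfying the reachability condition (R1), with dual representation 𝒯. Let T₁ ∈ 𝒯 be any extreme point of 𝒯 and, for each n ≥ 1, let hₙ be the unique solution in ℝ^𝒳 of the linear system hₙ = 𝟙_{Aᶜ} + 𝟙_{Aᶜ}·(Tₙhₙ), and let T_{n+1} be an extreme point of 𝒯 with T̲hₙ = T_{n+1}hₙ. Then the sequence {hₙ} is non-increasing (h_{n+1} ≤ hₙ for all n), its pointwise limit h_* := lim_{n→∞} hₙ exists, and h_* is the unique solution in ℝ^𝒳 of the system h = 𝟙_{Aᶜ} + 𝟙_{Aᶜ}·(T̲h). -/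
open Function Set Filter Topology

namespace Coherent

variable {X : Type*} [Fintype X] [Nonempty X] {T : (X → ℝ) → (X → ℝ)}

theorem le_apply (hT : Coherent T) {f : X → ℝ} {c : ℝ} (hc : ∀ y, c ≤ f y) (x : X) :
    c ≤ T f x :=
  (le_ciInf hc).trans (hT.2.2 f x)

theorem add_le (hT : Coherent T) (f g : X → ℝ) (x : X) : T f x + T g x ≤ T (f + g) x :=
  hT.2.1 f g x

theorem map_smul (hT : Coherent T) {a : ℝ} (ha : 0 ≤ a) (f : X → ℝ) (x : X) :
    T (a • f) x = a * T f x := by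
  rw [hT.1 a ha f, Pi.smul_apply, smul_eq_mul]

theorem add_neg_le (hT : Coherent T) (f : X → ℝ) (x : X) : T f x + T (-f) x ≤ 0 := by
  have h0 := hT.map_smul le_rfl (0 : X → ℝ) x
  have h1 := hT.add_le f (-f) x
  rw [smul_zero, zero_mul] at h0
  rwa [add_neg_cancel, h0] at h1

theorem apply_le (hT : Coherent T) {f : X → ℝ} {c : ℝ} (hc : ∀ y, f y ≤ c) (x : X) :
    T f x ≤ c := by
  have h1 := hT.add_neg_le f x
  have h2 := hT.le_apply (f := -f) (c := -c) (fun y => neg_le_neg (hc y)) x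
  linarith

theorem sub_le (hT : Coherent T) (f g : X → ℝ) (x : X) :
    T f x - T g x ≤ -T (-(f - g)) x := by
  have h1 := hT.add_le f (-(f - g)) x
  rw [show f + -(f - g) = g by abel] at h1
  linarith

theorem monotone_s17 (hT : Coherent T) : Monotone T := fun f g hfg x => by
  have h1 := hT.sub_le f g x
  have h2 := hT.le_apply (f := -(f - g)) (c := 0)
    (fun y => by simpa using hfg y) x
  linarith

theorem sub_le_norm (hT : Coherent T) (f g : X → ℝ) (x : X) : T f x - T g x ≤ ‖f - g‖ := by
  have h1 := hT.sub_le f g x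
  have h2 := hT.le_apply (f := -(f - g)) (c := -‖f - g‖)
    (fun y => neg_le_neg ((le_abs_self _).trans (norm_le_pi_norm (f - g) y))) x
  linarith

theorem abs_sub_le_norm (hT : Coherent T) (f g : X → ℝ) (x : X) :
    |T f x - T g x| ≤ ‖f - g‖ := by
  refine abs_sub_le_iff.2 ⟨hT.sub_le_norm f g x, ?_⟩
  rw [norm_sub_rev]
  exact hT.sub_le_norm g f x

theorem continuous (hT : Coherent T) : Continuous T := by
  refine (LipschitzWith.of_dist_le_mul (K := 1) fun f g => ?_).continuous
  rw [NNReal.coe_one, one_mul, dist_eq_norm, dist_eq_norm]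
  exact (pi_norm_le_iff_of_nonneg (norm_nonneg _)).2 fun x => hT.abs_sub_le_norm f g x

theorem iterate_indicator_le (hT : Coherent T) {A B : Set X} (hAB : A ⊆ B)
    (hB : ∀ x ∉ B, T (B.indicator 1) x ≤ 0) (n : ℕ) :
    T^[n] (A.indicator 1) ≤ B.indicator 1 := by
  induction n with
  | zero => exact indicator_le_indicator_of_subset hAB fun _ => zero_le_one
  | succ n ih =>
    rw [iterate_succ_apply']
    refine (hT.monotone_s17 ih).trans fun x => ?_
    by_cases hx : x ∈ B
    · rw [indicator_of_mem hx]
      exact hT.apply_le (fun y => indicator_le_self' (fun _ _ => zero_le_one) y) x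
    · rw [indicator_of_notMem hx]
      exact hB x hx

/-- Maximum principle: a function that is nonpositive on `A` and subharmonic outside `A` for the
conjugate map `f ↦ -T (-f)` is nonpositive. -/
theorem nonpos_of_le_conjugate (hT : Coherent T) {A : Set X} (hA : A.Nonempty) (hR : Reach A T)
    {d : X → ℝ} (hdA : ∀ x ∈ A, d x ≤ 0) (hd : ∀ x ∉ A, d x ≤ -T (-d) x) : d ≤ 0 := by
  obtain ⟨m, hm⟩ := Finite.exists_max d
  by_contra hneg
  obtain ⟨z, hz⟩ : ∃ z, 0 < d z := by simpa [Pi.le_def] using hneg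
  have hpos : 0 < d m := hz.trans_le (hm z)
  set B : Set X := {y | d y < d m}
  have hAB : A ⊆ B := fun y hy => (hdA y hy).trans_lt hpos
  obtain ⟨y₀, hy₀, hmin⟩ := B.exists_min_image (fun y => d m - d y) B.toFinite (hA.mono hAB)
  set ε := d m - d y₀
  have hε : 0 < ε := sub_pos.2 hy₀
  have hB : ∀ x ∉ B, T (B.indicator 1) x ≤ 0 := fun x hx => by
    have hx_eq : d x = d m := (hm x).antisymm (not_lt.1 hx)
    have h1 := hd x fun h => hx (hAB h)
    have h2 := hT.add_le (ε • B.indicator 1) (fun _ => -d m) x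
    have h3 : T (ε • B.indicator 1 + fun _ => -d m) x ≤ T (-d) x := by
      refine hT.monotone_s17 (fun y => ?_) x
      by_cases hy : y ∈ B
      · have := hmin y hy
        simp only [Pi.add_apply, Pi.smul_apply, indicator_of_mem hy, Pi.one_apply, smul_eq_mul,
          Pi.neg_apply]
        linarith
      · simpa [hy] using hm y
    have h4 := hT.le_apply (f := fun _ => -d m) (fun _ => le_rfl) x
    rw [hT.map_smul hε.le] at h2
    exact nonpos_of_mul_nonpos_right (by linarith : ε * T (B.indicator 1) x ≤ 0) hε
  have hmB : m ∉ B := lt_irrefl (d m)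
  obtain ⟨n, -, hn⟩ := hR m fun h => hmB (hAB h)
  have := hT.iterate_indicator_le hAB hB n m
  rw [indicator_of_notMem hmB] at this
  exact this.not_gt hn

end Coherent

theorem DualRep.apply_le_conjugate {X : Type*} [Fintype X] [Nonempty X]
    {Tl S : (X → ℝ) → (X → ℝ)} (hS : S ∈ DualRep Tl) (f : X → ℝ) (x : X) :
    S f x ≤ -Tl (-f) x := by
  have h1 := hS.2.2 (-f) x
  rw [hS.1.map_neg, Pi.neg_apply] at h1
  linarith

theorem eq_indicator_add_indicator_mul_iff {X : Type*} {A : Set X} {f g : X → ℝ} :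
    f = (Aᶜ : Set X).indicator 1 + (Aᶜ : Set X).indicator 1 * g ↔
      (∀ x ∈ A, f x = 0) ∧ ∀ x ∉ A, f x = 1 + g x := by
  rw [funext_iff]
  refine ⟨fun h => ⟨fun x hx => ?_, fun x hx => ?_⟩, fun h x => ?_⟩
  · simpa [hx] using h x
  · simpa [hx] using h x
  · by_cases hx : x ∈ A
    · simpa [hx] using h.1 x hx
    · simpa [hx] using h.2 x hx

theorem stmt17 {X : Type*} [Fintype X] [Nonempty X] (A : Set X)
    (hA : A.Nonempty) (hAc : (Aᶜ : Set X).Nonempty)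
    (Tl : (X → ℝ) → (X → ℝ)) (hTl : Coherent Tl) (hR : Reach A Tl)
    (T : ℕ → (X → ℝ) → (X → ℝ)) (h : ℕ → X → ℝ)
    (hext : ∀ n : ℕ, 1 ≤ n → T n ∈ Set.extremePoints ℝ (DualRep Tl))
    (hsol : ∀ n : ℕ, 1 ≤ n →
      h n = (Aᶜ : Set X).indicator 1 + (Aᶜ : Set X).indicator 1 * T n (h n))
    (hnext : ∀ n : ℕ, 1 ≤ n → Tl (h n) = T (n + 1) (h n)) :
    (∀ n : ℕ, 1 ≤ n → h (n + 1) ≤ h n) ∧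
    ∃ hstar : X → ℝ, Tendsto h atTop (𝓝 hstar) ∧
      (hstar = (Aᶜ : Set X).indicator 1 + (Aᶜ : Set X).indicator 1 * Tl hstar) ∧
      (∀ g : X → ℝ,
        g = (Aᶜ : Set X).indicator 1 + (Aᶜ : Set X).indicator 1 * Tl g → g = hstar) := by
  have hmem : ∀ n, 1 ≤ n → T n ∈ DualRep Tl := fun n hn => (hext n hn).1
  simp only [eq_indicator_add_indicator_mul_iff] at hsol ⊢
  have hanti : ∀ n, 1 ≤ n → h (n + 1) ≤ h n := fun n hn => by
    have hn' : 1 ≤ n + 1 := by lia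
    refine sub_nonpos.1 (hTl.nonpos_of_le_conjugate hA hR (fun x hx => ?_) fun x hx => ?_)
    · simp [(hsol n hn).1 x hx, (hsol _ hn').1 x hx]
    · have h1 := DualRep.apply_le_conjugate (hmem _ hn') (h (n + 1) - h n) x
      have h2 := (hmem n hn).2.2 (h n) x
      rw [(hmem _ hn').1.map_sub, ← hnext n hn, Pi.sub_apply] at h1
      rw [Pi.sub_apply, (hsol n hn).2 x hx, (hsol _ hn').2 x hx]
      linarith
  have hnonneg : ∀ n, 1 ≤ n → 0 ≤ h n := fun n hn => by
    refine neg_nonpos.1 (hTl.nonpos_of_le_conjugate hA hR (fun x hx => ?_) fun x hx => ?_)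
    · simp [(hsol n hn).1 x hx]
    · have h1 := DualRep.apply_le_conjugate (hmem n hn) (-h n) x
      rw [(hmem n hn).1.map_neg, Pi.neg_apply] at h1
      rw [Pi.neg_apply, (hsol n hn).2 x hx]
      linarith
  have hlim : ∀ x, ∃ l, Tendsto (fun n => h (n + 1) x) atTop (𝓝 l) := fun x =>
    ⟨_, tendsto_atTop_ciInf (antitone_nat_of_succ_le fun n => hanti (n + 1) (by lia) x)
      ⟨0, by rintro _ ⟨n, rfl⟩; exact hnonneg (n + 1) (by lia) x⟩⟩
  choose hstar hstar_lim using hlim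
  have htend : Tendsto h atTop (𝓝 hstar) :=
    (tendsto_add_atTop_iff_nat 1).1 (tendsto_pi_nhds.2 hstar_lim)
  have htend_succ : Tendsto (fun n => h (n + 1)) atTop (𝓝 hstar) :=
    (tendsto_add_atTop_iff_nat 1).2 htend
  have hstar_sol : (∀ x ∈ A, hstar x = 0) ∧ ∀ x ∉ A, hstar x = 1 + Tl hstar x := by
    refine ⟨fun x hx => ?_, fun x hx => ?_⟩
    · refine tendsto_nhds_unique (hstar_lim x) (tendsto_const_nhds.congr fun n => ?_)
      exact ((hsol (n + 1) (by lia)).1 x hx).symm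
    · have hTl_lim : Tendsto (fun n => Tl (h n) x) atTop (𝓝 (Tl hstar x)) :=
        tendsto_pi_nhds.1 ((hTl.continuous.tendsto hstar).comp htend) x
      have hdiff : Tendsto (fun n => T (n + 1) (h (n + 1)) x - Tl (h n) x) atTop (𝓝 0) := by
        have hnorm : Tendsto (fun n => ‖h (n + 1) - h n‖) atTop (𝓝 0) := by
          simpa using (htend_succ.sub htend).norm
        refine squeeze_zero_norm' ?_ hnorm
        filter_upwards [eventually_ge_atTop 1] with n hn
        rw [hnext n hn, Real.norm_eq_abs]
        exact (hmem (n + 1) (by lia)).2.1.abs_sub_le_norm _ _ x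
      have hsum := (hdiff.add hTl_lim).const_add 1
      rw [zero_add] at hsum
      refine tendsto_nhds_unique (hstar_lim x) (hsum.congr fun n => ?_)
      rw [(hsol (n + 1) (by lia)).2 x hx, sub_add_cancel]
  have hle : ∀ f g : X → ℝ, ((∀ x ∈ A, f x = 0) ∧ ∀ x ∉ A, f x = 1 + Tl f x) →
      ((∀ x ∈ A, g x = 0) ∧ ∀ x ∉ A, g x = 1 + Tl g x) → f ≤ g := fun f g hf hg => by
    refine sub_nonpos.1 (hTl.nonpos_of_le_conjugate hA hR (fun x hx => ?_) fun x hx => ?_)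
    · simp [hf.1 x hx, hg.1 x hx]
    · have := hTl.sub_le f g x
      rw [Pi.sub_apply, hf.2 x hx, hg.2 x hx]
      linarith
  exact ⟨hanti, hstar, htend, hstar_sol, fun g hg =>
    (hle g hstar hg hstar_sol).antisymm (hle hstar g hstar_sol hg)⟩
end
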